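/- The abelianization of the braid group B_n(T) of the torus (n ≥ 2) is isomorphic to ℤ × ℤ × ℤ/2. -/

import Mathlib

/-! Birman's presentation of the braid group `B_n(T)` of the torus:
generators `a`, `b`, `σ_1, ..., σ_{n-1}` (here `σ_{i+1}` is indexed by
`i : Fin (n-1)`) and relations as in the paper. -/

/-- Generators: `Sum.inl 0 = a`, `Sum.inl 1 = b`, `Sum.inr i = σ_{i+1}`. -/
abbrev TGen (n : ℕ) := Fin 2 ⊕ Fin (n - 1)

namespace TB

variable (n : ℕ)

def ga : FreeGroup (TGen n) := FreeGroup.of (Sum.inl 0)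
def gb : FreeGroup (TGen n) := FreeGroup.of (Sum.inl 1)
def gs (i : Fin (n - 1)) : FreeGroup (TGen n) := FreeGroup.of (Sum.inr i)

/-- The relators of Birman's presentation of `B_n(T)` (each relation `u = v`
is recorded as the relator `u * v⁻¹`). -/
def rels : Set (FreeGroup (TGen n)) :=
  { r |
    (∃ i j : Fin (n - 1), ((i : ℕ) + 2 ≤ (j : ℕ) ∨ (j : ℕ) + 2 ≤ (i : ℕ)) ∧
      r = gs n i * gs n j * (gs n j * gs n i)⁻¹) ∨
    (∃ i j : Fin (n - 1), (j : ℕ) = (i : ℕ) + 1 ∧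
      r = gs n i * gs n j * gs n i * (gs n j * gs n i * gs n j)⁻¹) ∨
    (∃ i : Fin (n - 1), 1 ≤ (i : ℕ) ∧ r = ga n * gs n i * (gs n i * ga n)⁻¹) ∨
    (∃ i : Fin (n - 1), 1 ≤ (i : ℕ) ∧ r = gb n * gs n i * (gs n i * gb n)⁻¹) ∨
    (∃ i : Fin (n - 1), (i : ℕ) = 0 ∧
      r = ((gs n i)⁻¹ * ga n * (gs n i)⁻¹ * ga n) *
          (ga n * (gs n i)⁻¹ * ga n * (gs n i)⁻¹)⁻¹) ∨
    (∃ i : Fin (n - 1), (i : ℕ) = 0 ∧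
      r = ((gs n i)⁻¹ * gb n * (gs n i)⁻¹ * gb n) *
          (gb n * (gs n i)⁻¹ * gb n * (gs n i)⁻¹)⁻¹) ∨
    (∃ i : Fin (n - 1), (i : ℕ) = 0 ∧
      r = ((gs n i)⁻¹ * ga n * (gs n i)⁻¹ * gb n) *
          (gb n * (gs n i)⁻¹ * ga n * gs n i)⁻¹) ∨
    (r = (ga n * (gb n)⁻¹ * (ga n)⁻¹ * gb n) *
         ((List.ofFn (gs n)).prod * (List.ofFn (gs n)).reverse.prod)⁻¹) }

/-- The braid group of the torus, via Birman's presentation. -/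
abbrev TorusBraid := PresentedGroup (rels n)

/-- The generator `a` of `B_n(T)`. -/
def A : TorusBraid n := PresentedGroup.of (Sum.inl 0)
/-- The generator `b` of `B_n(T)`. -/
def B : TorusBraid n := PresentedGroup.of (Sum.inl 1)
/-- The generator `σ_{i+1}` of `B_n(T)`. -/
def S (i : Fin (n - 1)) : TorusBraid n := PresentedGroup.of (Sum.inr i)

end TB

namespace TB

theorem comm_aux {G : Type*} [CommGroup G] (a b s : G) :
    s⁻¹ * a * s⁻¹ * b = b * s⁻¹ * a * s ↔ s * s = 1 := by
  have e : s⁻¹ * a * s⁻¹ * b = b * s⁻¹ * a * s⁻¹ := by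
    rw [mul_right_comm, mul_comm b s⁻¹, mul_right_comm s⁻¹ b a]
  rw [e, mul_right_inj, inv_eq_iff_mul_eq_one]

theorem lift_ok {G : Type*} [CommGroup G] (a b s : G) (hs : s * s = 1) (n : ℕ) :
    ∀ r ∈ rels n, FreeGroup.lift (Sum.elim ![a, b] (fun _ : Fin (n - 1) => s)) r = 1 := by
  intro r hr
  set φ := FreeGroup.lift (Sum.elim ![a, b] (fun _ : Fin (n - 1) => s)) with hφ
  have ha : φ (ga n) = a := by simp [hφ, ga]
  have hb : φ (gb n) = b := by simp [hφ, gb]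
  have hg : ∀ i, φ (gs n i) = s := by intro i; simp [hφ, gs]
  clear_value φ
  rcases hr with ⟨i, j, -, rfl⟩ | ⟨i, j, -, rfl⟩ | ⟨i, -, rfl⟩ | ⟨i, -, rfl⟩ | ⟨i, -, rfl⟩ |
    ⟨i, -, rfl⟩ | ⟨i, -, rfl⟩ | rfl
  all_goals rw [map_mul, map_inv, mul_inv_eq_one]
  all_goals simp only [map_mul, map_inv, ha, hb, hg]
  · exact mul_comm _ _
  · exact mul_comm _ _
  · rw [mul_comm s⁻¹ a, mul_right_comm (a * s⁻¹) s⁻¹ a]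
  · rw [mul_comm s⁻¹ b, mul_right_comm (b * s⁻¹) s⁻¹ b]
  · exact (comm_aux a b s).2 hs
  · have hl : List.map φ (List.ofFn (gs n)) = List.replicate (n - 1) s := by
      rw [List.map_ofFn, ← List.ofFn_const]
      congr 1
      funext i
      exact hg i
    rw [map_list_prod, map_list_prod, List.map_reverse, hl, List.reverse_replicate,
      List.prod_replicate, ← mul_pow, hs, one_pow, mul_right_comm a, mul_inv_cancel, one_mul,
      inv_mul_cancel]

theorem S_eq (n : ℕ) (i j : Fin (n - 1)) :
    Abelianization.of (S n i) = Abelianization.of (S n j) := by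
  have key : ∀ i j : Fin (n - 1), (j : ℕ) = (i : ℕ) + 1 →
      Abelianization.of (S n i) = Abelianization.of (S n j) := by
    intro i j h
    have h1 : PresentedGroup.mk (rels n)
        (gs n i * gs n j * gs n i * (gs n j * gs n i * gs n j)⁻¹) = 1 :=
      PresentedGroup.one_of_mem (Or.inr (Or.inl ⟨i, j, h, rfl⟩))
    have h3 := congrArg Abelianization.of h1
    simp only [map_mul, map_inv, map_one, mul_inv_eq_one] at h3
    change Abelianization.of (S n i) * Abelianization.of (S n j) * Abelianization.of (S n i) =
      Abelianization.of (S n j) * Abelianization.of (S n i) * Abelianization.of (S n j) at h3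
    rw [mul_comm (Abelianization.of (S n j))] at h3
    exact mul_left_cancel h3
  have h0 : ∀ (k : ℕ) (hk : k < n - 1), Abelianization.of (S n ⟨k, hk⟩) =
      Abelianization.of (S n ⟨0, by omega⟩) := by
    intro k
    induction k with
    | zero => intro _; rfl
    | succ k ih => intro hk; rw [← ih (by omega)]; exact (key _ _ rfl).symm
  exact (h0 i i.2).trans (h0 j j.2).symm

theorem S_sq (n : ℕ) (h : 0 < n - 1) :
    Abelianization.of (S n ⟨0, h⟩) * Abelianization.of (S n ⟨0, h⟩) = 1 := by
  set i : Fin (n - 1) := ⟨0, h⟩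
  have h1 : PresentedGroup.mk (rels n)
      (((gs n i)⁻¹ * ga n * (gs n i)⁻¹ * gb n) * (gb n * (gs n i)⁻¹ * ga n * gs n i)⁻¹) = 1 :=
    PresentedGroup.one_of_mem
      (Or.inr (Or.inr (Or.inr (Or.inr (Or.inr (Or.inr (Or.inl ⟨i, rfl, rfl⟩)))))))
  have h3 := congrArg Abelianization.of h1
  simp only [map_mul, map_inv, map_one] at h3
  rw [← comm_aux (Abelianization.of (A n)) (Abelianization.of (B n)), ← mul_inv_eq_one]
  exact h3

end TB

/-- The abelianization of the braid group `B_n(T)` of the torus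
(`n ≥ 2`) is isomorphic to `ℤ × ℤ × ℤ/2`. -/
theorem abelianization_torus_braid (n : ℕ) (hn : 2 ≤ n) :
    Nonempty (Abelianization (TB.TorusBraid n) ≃* Multiplicative (ℤ × ℤ × ZMod 2)) := by
  have hpos : 0 < n - 1 := by omega
  let s := Abelianization.of (TB.S n ⟨0, hpos⟩)
  have hs : s * s = 1 := TB.S_sq n hpos
  let f : Abelianization (TB.TorusBraid n) →* Multiplicative (ℤ × ℤ × ZMod 2) :=
    Abelianization.lift (PresentedGroup.toGroup (TB.lift_ok
      (Multiplicative.ofAdd ((1, 0, 0) : ℤ × ℤ × ZMod 2)) (Multiplicative.ofAdd (0, 1, 0))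
      (Multiplicative.ofAdd (0, 0, 1)) (by decide) n))
  let g' : ℤ × ℤ × ZMod 2 →+ Additive (Abelianization (TB.TorusBraid n)) :=
    (zmultiplesHom _ (Additive.ofMul (Abelianization.of (TB.A n)))).coprod
      ((zmultiplesHom _ (Additive.ofMul (Abelianization.of (TB.B n)))).coprod
        (ZMod.lift 2 ⟨zmultiplesHom _ (Additive.ofMul s), by
          simp only [zmultiplesHom_apply]
          rw [← ofMul_zpow]
          simp [zpow_ofNat, pow_two, hs]⟩))
  let g : Multiplicative (ℤ × ℤ × ZMod 2) →* Abelianization (TB.TorusBraid n) :=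
    AddMonoidHom.toMultiplicativeLeft g'
  have gs1 : g (Multiplicative.ofAdd (0, 0, 1)) = s := by
    have : ZMod.lift 2 (⟨zmultiplesHom _ (Additive.ofMul s), by
          simp only [zmultiplesHom_apply]
          rw [← ofMul_zpow]
          simp [zpow_ofNat, pow_two, hs]⟩ : {f : ℤ →+ Additive (Abelianization (TB.TorusBraid n)) // f (2:ℕ) = 0}) ((1:ℤ) : ZMod 2) = Additive.ofMul s := by
      rw [ZMod.lift_coe]; simp
    simp only [Int.cast_one] at this
    simp [g, g', this]
  have ga1 : g (Multiplicative.ofAdd (1, 0, 0)) = Abelianization.of (TB.A n) := by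
    simp [g, g']
  have gb1 : g (Multiplicative.ofAdd (0, 1, 0)) = Abelianization.of (TB.B n) := by
    simp [g, g']
  have fa : f (Abelianization.of (TB.A n)) = Multiplicative.ofAdd (1, 0, 0) := by
    simp [f, TB.A]
  have fb : f (Abelianization.of (TB.B n)) = Multiplicative.ofAdd (0, 1, 0) := by
    simp [f, TB.B]
  have fs : ∀ i, f (Abelianization.of (TB.S n i)) = Multiplicative.ofAdd (0, 0, 1) := by
    intro i; simp [f, TB.S]
  refine ⟨MonoidHom.toMulEquiv f g ?_ ?_⟩
  · apply Abelianization.hom_ext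
    apply PresentedGroup.ext
    rintro (i | i)
    · fin_cases i
      · change g (f (Abelianization.of (TB.A n))) = Abelianization.of (TB.A n)
        rw [fa, ga1]
      · change g (f (Abelianization.of (TB.B n))) = Abelianization.of (TB.B n)
        rw [fb, gb1]
    · change g (f (Abelianization.of (TB.S n i))) = Abelianization.of (TB.S n i)
      rw [fs, gs1]
      exact TB.S_eq n _ _
  · refine MonoidHom.ext fun x => ?_
    have hx : x = Multiplicative.ofAdd (1, 0, 0) ^ (x.toAdd.1) *
        Multiplicative.ofAdd (0, 1, 0) ^ (x.toAdd.2.1) *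
        Multiplicative.ofAdd (0, 0, 1) ^ (x.toAdd.2.2.val) := by
      apply Multiplicative.toAdd.injective
      simp
    have : f (g x) = x := by
      conv_lhs => rw [hx]
      simp only [map_mul, map_zpow, map_pow, ga1, gb1, gs1, fa, fb]
      rw [fs]
      exact hx.symm
    exact this
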